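/- Let χ be a primitive Dirichlet character (mod n) and let s be an integer. Then Σ_{k=1}^{n} τ(gcd(k − s, n)) χ(k) = χ(s), where τ is the number-of-divisors function. -/

import Mathlib

open Finset

/-- A primitive character sums to zero over each residue class modulo a proper divisor of its
modulus. -/
lemma DirichletCharacter.IsPrimitive.sum_filter_castHom_eq_zero {R : Type*} [CommRing R]
    [IsDomain R] {n d : ℕ} [NeZero n] {χ : DirichletCharacter R n} (hχ : χ.IsPrimitive)
    (hd : d ∣ n) (hdn : d ≠ n) (a : ZMod d) :
    ∑ x : ZMod n with ZMod.castHom hd (ZMod d) x = a, χ x = 0 := by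
  have hker : ¬ (ZMod.unitsMap hd).ker ≤ χ.toUnitHom.ker := by
    rw [← DirichletCharacter.factorsThrough_iff_ker_unitsMap hd]
    intro h
    have hle : χ.conductor ≤ d := Nat.sInf_le h
    rw [hχ] at hle
    exact hdn (le_antisymm (Nat.le_of_dvd (NeZero.pos n) hd) hle)
  obtain ⟨u, hu, hχu⟩ := SetLike.not_le_iff_exists.mp hker
  have hχu : χ u ≠ 1 := by
    simpa [MonoidHom.mem_ker, Units.ext_iff] using hχu
  have hu : ZMod.castHom hd (ZMod d) u = 1 := by
    simpa [MonoidHom.mem_ker, Units.ext_iff, ZMod.unitsMap_def] using hu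
  refine eq_zero_of_mul_eq_self_left hχu ?_
  rw [mul_sum]
  refine sum_equiv (Units.mulLeft u) (fun x ↦ ?_) (fun x _ ↦ ?_)
  · simp [-ZMod.castHom_apply, hu]
  · simp

/-- Summing a function on `ZMod n` over the representatives `1, …, n`. -/
lemma ZMod.sum_Icc_natCast {M : Type*} [AddCommMonoid M] (n : ℕ) [NeZero n] (f : ZMod n → M) :
    ∑ k ∈ Icc 1 n, f (k : ZMod n) = ∑ x : ZMod n, f x := by
  have hinj : Set.InjOn (Nat.cast : ℕ → ZMod n) (Icc 1 n : Finset ℕ) := by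
    intro a ha b hb hab
    rw [mem_coe, mem_Icc] at ha hb
    have hdvd := (ZMod.intCast_eq_intCast_iff_dvd_sub (a : ℤ) b n).mp (by simpa using hab)
    have := Int.eq_zero_of_abs_lt_dvd hdvd (by rw [abs_lt]; omega)
    omega
  rw [← sum_image hinj]
  congr 1
  apply eq_univ_of_card
  rw [card_image_of_injOn hinj, Nat.card_Icc, ZMod.card, Nat.add_sub_cancel]

/-- The number of divisors of `gcd a n` as a sum of indicators over the divisors of `n`. -/
lemma Int.card_divisors_gcd_natCast (a : ℤ) {n : ℕ} (hn : n ≠ 0) :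
    (Int.gcd a n).divisors.card = ∑ d ∈ n.divisors, if (d : ℤ) ∣ a then 1 else 0 := by
  rw [← card_filter]
  congr 1
  ext d
  simp [hn, Int.natCast_dvd_natCast, and_comm, Int.dvd_coe_gcd_iff,
    ← Int.natCast_dvd_natCast (n := Int.gcd a n)]

/-- Let `χ` be a primitive Dirichlet character (mod `n`) and let `s` be an integer.  Then
`∑_{k=1}^{n} τ (gcd (k - s) n) χ(k) = χ(s)`, where `τ` is the number-of-divisors
function. -/
theorem menon_primitive_character_tau (n : ℕ) (hn : 0 < n)
    (χ : DirichletCharacter ℂ n) (hprim : χ.IsPrimitive) (s : ℤ) :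
    ∑ k ∈ Finset.Icc 1 n,
        ((Int.gcd ((k : ℤ) - s) (n : ℤ)).divisors.card : ℂ) * χ (k : ZMod n)
      = χ ((s : ℤ) : ZMod n) := by
  have : NeZero n := ⟨hn.ne'⟩
  have hclass (d : ℕ) (hd : d ∣ n) :
      ∑ k ∈ Icc 1 n, (if (d : ℤ) ∣ (k : ℤ) - s then χ (k : ZMod n) else 0) =
        ∑ x : ZMod n with ZMod.castHom hd (ZMod d) x = (s : ZMod d), χ x := by
    rw [sum_filter, ← ZMod.sum_Icc_natCast]
    refine sum_congr rfl fun k _ ↦ if_congr ?_ rfl rfl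
    rw [map_natCast, eq_comm, ← ZMod.intCast_eq_intCast_iff_dvd_sub, Int.cast_natCast]
  simp_rw [Int.card_divisors_gcd_natCast _ hn.ne', Nat.cast_sum, sum_mul, Nat.cast_ite,
    Nat.cast_one, Nat.cast_zero, ite_mul, one_mul, zero_mul]
  rw [sum_comm, sum_eq_single_of_mem n (Nat.mem_divisors_self n hn.ne')]
  · rw [hclass n dvd_rfl]
    simp [sum_filter]
  · intro d hd hdn
    rw [hclass d (Nat.dvd_of_mem_divisors hd)]
    exact hprim.sum_filter_castHom_eq_zero _ hdn _
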